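/- Let F₁, F₂, F₃, F₄ be families of nonempty compact connected sets in ℝ² such that every collection of four sets, one chosen from each family F_i, has a common line transversal. Then there exists an index i ∈ {1,2,3,4} such that F_i is pierced by 2 lines. -/

import Mathlib

open Set

/-- The Euclidean plane ℝ². -/
abbrev Plane := EuclideanSpace ℝ (Fin 2)

/-- A line in the plane: a one-dimensional affine subspace of ℝ². -/
def IsLine (l : Set Plane) : Prop :=
  ∃ p v : Plane, v ≠ 0 ∧ l = {x | ∃ t : ℝ, x = p + t • v}

/-- A triple of sets `A, B, C` is tight if
`conv(A ∪ B) ∩ conv(A ∪ C) ∩ conv(B ∪ C) ≠ ∅`. -/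
def Tight (A B C : Set Plane) : Prop :=
  (convexHull ℝ (A ∪ B) ∩ convexHull ℝ (A ∪ C) ∩ convexHull ℝ (B ∪ C)).Nonempty

/-- A family `F` of sets in the plane is pierced by `k` lines if there are `k` lines
such that every member of `F` intersects their union. -/
def PiercedByLines (F : Set (Set Plane)) (k : ℕ) : Prop :=
  ∃ L : Fin k → Set Plane, (∀ i, IsLine (L i)) ∧ ∀ S ∈ F, (S ∩ ⋃ i, L i).Nonempty


def lbT (a b c : Fin 4) : ZMod 2 :=
  if a ≠ 3 ∧ b ≠ 3 ∧ c ≠ 3 ∧ a ≠ b ∧ b ≠ c ∧ a ≠ c then 1 else 0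
def lbF (a b c d : Fin 4) : ZMod 2 :=
  if a ≠ b ∧ a ≠ c ∧ a ≠ d ∧ b ≠ c ∧ b ≠ d ∧ c ≠ d then 1 else 0
def lbE (a b : Fin 4) : ZMod 2 := if (a = 0 ∧ b = 1) ∨ (a = 1 ∧ b = 0) then 1 else 0
def lbP (a : Fin 4) : ZMod 2 := if a = 0 then 1 else 0

theorem lbF_eq : ∀ a b c d, lbF a b c d = lbT b c d + lbT a c d + lbT a b d + lbT a b c := by
  decide
theorem lbT_eq : ∀ a b c : Fin 4, a ≠ 3 → b ≠ 3 → c ≠ 3 →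
    lbT a b c = lbE b c + lbE a c + lbE a b := by
  decide
theorem lbE_eq : ∀ a b : Fin 4, a ≠ 3 → b ≠ 3 → a ≠ 2 → b ≠ 2 →
    lbE a b = lbP b - lbP a := by
  decide

theorem lbT_zero : ∀ x : Fin 4, x ≠ 3 → ∀ a b c : Fin 4, a ≠ x → b ≠ x → c ≠ x →
    lbT a b c = 0 := by
  decide
theorem lbE_zero : ∀ x : Fin 4, x ≠ 3 → x ≠ 2 → ∀ a b : Fin 4, a ≠ x → b ≠ x →
    lbE a b = 0 := by
  decide

theorem sperner (N : ℕ) (L : ℕ → ℕ → ℕ → Fin 4)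
    (h0 : ∀ i j k, i ≤ N → j ≤ N → k ≤ N → (i = 0 ∨ j = 0 ∨ k = 0) → L i j k ≠ 0)
    (h1 : ∀ i j k, i ≤ N → j ≤ N → k ≤ N → (i = N ∨ j = 0 ∨ k = 0) → L i j k ≠ 1)
    (h2 : ∀ i j k, i ≤ N → j ≤ N → k ≤ N → (j = N ∨ k = 0) → L i j k ≠ 2)
    (h3 : ∀ i j k, i ≤ N → j ≤ N → k ≤ N → k = N → L i j k ≠ 3) :
    ∃ i j k, i < N ∧ j < N ∧ k < N ∧
      (lbF (L i j k) (L (i+1) j k) (L (i+1) (j+1) k) (L (i+1) (j+1) (k+1)) ≠ 0 ∨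
       lbF (L i j k) (L (i+1) j k) (L (i+1) j (k+1)) (L (i+1) (j+1) (k+1)) ≠ 0 ∨
       lbF (L i j k) (L i (j+1) k) (L (i+1) (j+1) k) (L (i+1) (j+1) (k+1)) ≠ 0 ∨
       lbF (L i j k) (L i (j+1) k) (L i (j+1) (k+1)) (L (i+1) (j+1) (k+1)) ≠ 0 ∨
       lbF (L i j k) (L i j (k+1)) (L (i+1) j (k+1)) (L (i+1) (j+1) (k+1)) ≠ 0 ∨
       lbF (L i j k) (L i j (k+1)) (L i (j+1) (k+1)) (L (i+1) (j+1) (k+1)) ≠ 0) := by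
  by_contra! hcon
  have two : (2 : ZMod 2) = 0 := rfl
  let X : ℕ → ℕ → ℕ → ZMod 2 := fun i j k =>
    lbT (L i j k) (L i (j+1) k) (L i (j+1) (k+1)) + lbT (L i j k) (L i j (k+1)) (L i (j+1) (k+1))
  let Y : ℕ → ℕ → ℕ → ZMod 2 := fun j i k =>
    lbT (L i j k) (L (i+1) j k) (L (i+1) j (k+1)) + lbT (L i j k) (L i j (k+1)) (L (i+1) j (k+1))
  let Z : ℕ → ℕ → ℕ → ZMod 2 := fun k i j =>
    lbT (L i j k) (L (i+1) j k) (L (i+1) (j+1) k) + lbT (L i j k) (L i (j+1) k) (L (i+1) (j+1) k)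
  have key : ∀ i j k, i < N → j < N → k < N →
      (X (i+1) j k - X i j k) + (Y (j+1) i k - Y j i k) + (Z (k+1) i j - Z k i j) = 0 := by
    intro i j k hi hj hk
    obtain ⟨e1, e2, e3, e4, e5, e6⟩ := hcon i j k hi hj hk
    rw [lbF_eq] at e1 e2 e3 e4 e5 e6
    simp only [X, Y, Z]
    generalize L i j k = a at *
    generalize L (i+1) (j+1) (k+1) = b at *
    generalize L (i+1) j k = c at *
    generalize L i (j+1) k = d at *
    generalize L i j (k+1) = e at *
    generalize L (i+1) (j+1) k = f at *
    generalize L (i+1) j (k+1) = g at *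
    generalize L i (j+1) (k+1) = h at *
    linear_combination e1 + e2 + e3 + e4 + e5 + e6 - two * (
      lbT a c b + lbT a d b + lbT a e b + lbT a f b + lbT a g b + lbT a h b
      + lbT a d h + lbT a e h + lbT a c g + lbT a e g + lbT a c f + lbT a d f)
  have hX : ∑ i ∈ Finset.range N, ∑ j ∈ Finset.range N, ∑ k ∈ Finset.range N,
      (X (i+1) j k - X i j k) = 0 := by
    rw [Finset.sum_comm]
    refine Finset.sum_eq_zero fun j hj => ?_
    rw [Finset.sum_comm]
    refine Finset.sum_eq_zero fun k hk => ?_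
    rw [Finset.sum_range_sub (fun i => X i j k)]
    rw [Finset.mem_range] at hj hk
    simp only [X]
    rw [lbT_zero 1 (by decide), lbT_zero 1 (by decide), lbT_zero 0 (by decide),
      lbT_zero 0 (by decide)]
    · simp
    all_goals first
      | (apply h0 <;> omega)
      | (apply h1 <;> omega)
  have hY : ∑ i ∈ Finset.range N, ∑ j ∈ Finset.range N, ∑ k ∈ Finset.range N,
      (Y (j+1) i k - Y j i k) = 0 := by
    refine Finset.sum_eq_zero fun j hj => ?_
    rw [Finset.sum_comm]
    refine Finset.sum_eq_zero fun k hk => ?_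
    rw [Finset.sum_range_sub (fun i => Y i j k)]
    rw [Finset.mem_range] at hj hk
    simp only [Y]
    rw [lbT_zero 2 (by decide), lbT_zero 2 (by decide), lbT_zero 0 (by decide),
      lbT_zero 0 (by decide)]
    · simp
    all_goals first
      | (apply h0 <;> omega)
      | (apply h2 <;> omega)
  have hZ : ∑ i ∈ Finset.range N, ∑ j ∈ Finset.range N, ∑ k ∈ Finset.range N,
      (Z (k+1) i j - Z k i j) = ∑ i ∈ Finset.range N, ∑ j ∈ Finset.range N, Z N i j := by
    refine Finset.sum_congr rfl fun i hi => ?_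
    refine Finset.sum_congr rfl fun j hj => ?_
    rw [Finset.sum_range_sub (fun k => Z k i j)]
    rw [Finset.mem_range] at hi hj
    have : Z 0 i j = 0 := by
      simp only [Z]
      rw [lbT_zero 0 (by decide), lbT_zero 0 (by decide)]
      · simp
      all_goals (apply h0 <;> omega)
    rw [this, sub_zero]
  have tot : ∑ i ∈ Finset.range N, ∑ j ∈ Finset.range N, Z N i j = 0 := by
    rw [← hZ]
    have : ∑ i ∈ Finset.range N, ∑ j ∈ Finset.range N, ∑ k ∈ Finset.range N,
      ((X (i+1) j k - X i j k) + (Y (j+1) i k - Y j i k) + (Z (k+1) i j - Z k i j)) = 0 := by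
      refine Finset.sum_eq_zero fun i hi => ?_
      refine Finset.sum_eq_zero fun j hj => ?_
      refine Finset.sum_eq_zero fun k hk => ?_
      rw [Finset.mem_range] at hi hj hk
      exact key i j k hi hj hk
    simp only [Finset.sum_add_distrib] at this
    rw [hX, hY] at this
    simpa using this
  let U : ℕ → ℕ → ZMod 2 := fun i j => lbE (L i j N) (L i (j+1) N)
  let V : ℕ → ℕ → ZMod 2 := fun j i => lbE (L i j N) (L (i+1) j N)
  have key2 : ∀ i j, i < N → j < N →
      Z N i j = (U (i+1) j - U i j) + (V (j+1) i - V j i) := by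
    intro i j hi hj
    simp only [Z, U, V]
    rw [lbT_eq, lbT_eq]
    · linear_combination two * (lbE (L i j N) (L (i+1) (j+1) N) + lbE (L i j N) (L (i+1) j N)
        + lbE (L i j N) (L i (j+1) N))
    all_goals (apply h3 <;> omega)
  have hU : ∑ i ∈ Finset.range N, ∑ j ∈ Finset.range N, (U (i+1) j - U i j) = 0 := by
    rw [Finset.sum_comm]
    refine Finset.sum_eq_zero fun j hj => ?_
    rw [Finset.sum_range_sub (fun i => U i j)]
    rw [Finset.mem_range] at hj
    simp only [U]
    rw [lbE_zero 1 (by decide) (by decide), lbE_zero 0 (by decide) (by decide)]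
    · simp
    all_goals first
      | (apply h0 <;> omega)
      | (apply h1 <;> omega)
  have hV : ∑ i ∈ Finset.range N, ∑ j ∈ Finset.range N, (V (j+1) i - V j i)
      = ∑ i ∈ Finset.range N, V N i := by
    refine Finset.sum_congr rfl fun i hi => ?_
    rw [Finset.sum_range_sub (fun j => V j i)]
    rw [Finset.mem_range] at hi
    have : V 0 i = 0 := by
      simp only [V]
      rw [lbE_zero 0 (by decide) (by decide)]
      all_goals (apply h0 <;> omega)
    rw [this, sub_zero]
  have hV2 : ∑ i ∈ Finset.range N, V N i = lbP (L N N N) - lbP (L 0 N N) := by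
    rw [← Finset.sum_range_sub (fun i => lbP (L i N N))]
    refine Finset.sum_congr rfl fun i hi => ?_
    rw [Finset.mem_range] at hi
    simp only [V]
    apply lbE_eq
    · apply h3 <;> omega
    · apply h3 <;> omega
    · apply h2 <;> omega
    · apply h2 <;> omega
  have tot2 : ∑ i ∈ Finset.range N, ∑ j ∈ Finset.range N, Z N i j
      = lbP (L N N N) - lbP (L 0 N N) := by
    rw [← hV2, ← hV, ← zero_add (∑ i ∈ Finset.range N, ∑ j ∈ Finset.range N, (V (j+1) i - V j i)),
      ← hU, ← Finset.sum_add_distrib]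
    refine Finset.sum_congr rfl fun i hi => ?_
    rw [← Finset.sum_add_distrib]
    refine Finset.sum_congr rfl fun j hj => ?_
    rw [Finset.mem_range] at hi hj
    exact key2 i j hi hj
  rw [tot] at tot2
  have n1 := h1 N N N le_rfl le_rfl le_rfl (Or.inl rfl)
  have n2 := h2 N N N le_rfl le_rfl le_rfl (Or.inl rfl)
  have n3 := h3 N N N le_rfl le_rfl le_rfl rfl
  have n0 := h0 0 N N (by omega) le_rfl le_rfl (Or.inl rfl)
  have : ∀ a b : Fin 4, a ≠ 1 → a ≠ 2 → a ≠ 3 → b ≠ 0 → (0 : ZMod 2) ≠ lbP a - lbP b := by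
    decide
  exact this _ _ n1 n2 n3 n0 tot2

theorem lbF_inj : ∀ a b c d : Fin 4, lbF a b c d ≠ 0 →
    Function.Injective ![a, b, c, d] := by
  intro a b c d h
  have : a ≠ b ∧ a ≠ c ∧ a ≠ d ∧ b ≠ c ∧ b ≠ d ∧ c ≠ d := by
    by_contra h'
    exact h (if_neg h')
  obtain ⟨_, _, _, _, _, _⟩ := this
  intro x y hxy
  fin_cases x <;> fin_cases y <;> simp_all [eq_comm]

theorem sperner' (N : ℕ) (L : ℕ → ℕ → ℕ → Fin 4)
    (h0 : ∀ i j k, i ≤ N → j ≤ N → k ≤ N → (i = 0 ∨ j = 0 ∨ k = 0) → L i j k ≠ 0)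
    (h1 : ∀ i j k, i ≤ N → j ≤ N → k ≤ N → (i = N ∨ j = 0 ∨ k = 0) → L i j k ≠ 1)
    (h2 : ∀ i j k, i ≤ N → j ≤ N → k ≤ N → (j = N ∨ k = 0) → L i j k ≠ 2)
    (h3 : ∀ i j k, i ≤ N → j ≤ N → k ≤ N → k = N → L i j k ≠ 3) :
    ∃ i j k, i < N ∧ j < N ∧ k < N ∧ ∃ a b c : Fin 4 → ℕ,
      (∀ m, (a m = i ∨ a m = i + 1) ∧ (b m = j ∨ b m = j + 1) ∧ (c m = k ∨ c m = k + 1) ∧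
        a m + b m + c m = i + j + k + m) ∧ Function.Injective fun m => L (a m) (b m) (c m) := by
  obtain ⟨i, j, k, hi, hj, hk, h⟩ := sperner N L h0 h1 h2 h3
  refine ⟨i, j, k, hi, hj, hk, ?_⟩
  have fin : ∀ a b c : Fin 4 → ℕ,
      lbF (L (a 0) (b 0) (c 0)) (L (a 1) (b 1) (c 1)) (L (a 2) (b 2) (c 2))
        (L (a 3) (b 3) (c 3)) ≠ 0 → Function.Injective fun m => L (a m) (b m) (c m) := by
    intro a b c h
    have := lbF_inj _ _ _ _ h
    convert this using 1
    funext m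
    fin_cases m <;> rfl
  rcases h with h | h | h | h | h | h
  · refine ⟨![i, i+1, i+1, i+1], ![j, j, j+1, j+1], ![k, k, k, k+1], ?_, fin _ _ _ h⟩
    intro m; fin_cases m <;> simp <;> omega
  · refine ⟨![i, i+1, i+1, i+1], ![j, j, j, j+1], ![k, k, k+1, k+1], ?_, fin _ _ _ h⟩
    intro m; fin_cases m <;> simp <;> omega
  · refine ⟨![i, i, i+1, i+1], ![j, j+1, j+1, j+1], ![k, k, k, k+1], ?_, fin _ _ _ h⟩
    intro m; fin_cases m <;> simp <;> omega
  · refine ⟨![i, i, i, i+1], ![j, j+1, j+1, j+1], ![k, k, k+1, k+1], ?_, fin _ _ _ h⟩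
    intro m; fin_cases m <;> simp <;> omega
  · refine ⟨![i, i, i+1, i+1], ![j, j, j, j+1], ![k, k+1, k+1, k+1], ?_, fin _ _ _ h⟩
    intro m; fin_cases m <;> simp <;> omega
  · refine ⟨![i, i, i, i+1], ![j, j, j+1, j+1], ![k, k+1, k+1, k+1], ?_, fin _ _ _ h⟩
    intro m; fin_cases m <;> simp <;> omega

theorem line_of_eq (a b c : ℝ) (h : a ≠ 0 ∨ b ≠ 0) :
    ∃ l : Set Plane, IsLine l ∧ ∀ p : Plane, a * p 0 + b * p 1 + c = 0 → p ∈ l := by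
  have hn : a ^ 2 + b ^ 2 ≠ 0 := by
    rcases h with h | h <;> positivity
  refine ⟨_, ⟨!₂[-a * c / (a^2+b^2), -b * c / (a^2+b^2)], !₂[-b, a], ?_, rfl⟩, ?_⟩
  · intro h0
    have e0 := congrArg (fun q : Plane => q 0) h0
    have e1 := congrArg (fun q : Plane => q 1) h0
    simp at e0 e1
    rcases h with h | h
    · exact h e1
    · exact h e0
  · intro p hp
    refine ⟨(a * p 1 - b * p 0) / (a^2+b^2), ?_⟩
    ext i
    fin_cases i
    · simp
      field_simp
      linear_combination (a) * hp
    · simp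
      field_simp
      linear_combination (b) * hp

theorem eq_of_line (l : Set Plane) (h : IsLine l) :
    ∃ w : ℝ × ℝ × ℝ, ‖w‖ = 1 ∧ ∀ p ∈ l, w.1 * p 0 + w.2.1 * p 1 + w.2.2 = 0 := by
  obtain ⟨q, v, hv, rfl⟩ := h
  let w : ℝ × ℝ × ℝ := (- v 1, v 0, v 1 * q 0 - v 0 * q 1)
  have hw : w ≠ 0 := by
    intro h
    apply hv
    simp only [w, Prod.mk_eq_zero] at h
    ext i
    fin_cases i
    · simpa using h.2.1
    · simpa using h.1
  refine ⟨‖w‖⁻¹ • w, ?_, ?_⟩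
  · rw [norm_smul, norm_inv, norm_norm, inv_mul_cancel₀ (norm_ne_zero_iff.2 hw)]
  · rintro p ⟨t, rfl⟩
    simp [w]
    ring

theorem isOpen_forall_cpt {X : Type*} [TopologicalSpace X] {K : Set Plane} (hK : IsCompact K)
    (W : Set (X × Plane)) (hW : IsOpen W) : IsOpen {x | ∀ p ∈ K, (x, p) ∈ W} := by
  rw [isOpen_iff_mem_nhds]
  intro x hx
  refine hK.eventually_forall_of_forall_eventually ?_
  intro p hp
  exact hW.mem_nhds (hx p hp)

theorem exists_finite (F : Set (Set Plane)) (hc : ∀ S ∈ F, IsCompact S)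
    (hnp : ¬ PiercedByLines F 2) :
    ∃ F' : Set (Set Plane), F' ⊆ F ∧ F'.Finite ∧ ¬ PiercedByLines F' 2 := by
  by_contra! hcon
  apply hnp
  let Q : (ℝ × ℝ × ℝ) → Plane → ℝ := fun w p => w.1 * p 0 + w.2.1 * p 1 + w.2.2
  let t : F → Set ((ℝ × ℝ × ℝ) × (ℝ × ℝ × ℝ)) := fun S =>
    {w | ∀ p ∈ (S : Set Plane), (w, p) ∈ {x : ((ℝ × ℝ × ℝ) × (ℝ × ℝ × ℝ)) × Plane |
      Q x.1.1 x.2 * Q x.1.2 x.2 ≠ 0}}ᶜ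
  have hcomp : IsCompact (Metric.sphere (0 : ℝ × ℝ × ℝ) 1 ×ˢ Metric.sphere (0 : ℝ × ℝ × ℝ) 1) :=
    (isCompact_sphere _ _).prod (isCompact_sphere _ _)
  have := hcomp.inter_iInter_nonempty t ?_ ?_
  · obtain ⟨⟨w1, w2⟩, ⟨hw1, hw2⟩, hw⟩ := this
    have ex : ∀ w : ℝ × ℝ × ℝ, w ∈ Metric.sphere (0 : ℝ × ℝ × ℝ) 1 →
        ∃ l : Set Plane, IsLine l ∧ ∀ p, Q w p = 0 → p ∈ l := by
      intro w hw
      by_cases h : w.1 ≠ 0 ∨ w.2.1 ≠ 0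
      · exact line_of_eq _ _ _ h
      · push Not at h
        obtain ⟨l, hl, -⟩ := line_of_eq 1 0 0 (Or.inl one_ne_zero)
        refine ⟨l, hl, fun p hp => ?_⟩
        exfalso
        simp only [Q, h.1, h.2] at hp
        have h0 : w = 0 := by
          refine Prod.ext h.1 (Prod.ext h.2 ?_)
          simpa using hp
        simp [h0] at hw
    obtain ⟨l1, hl1, h1⟩ := ex w1 hw1
    obtain ⟨l2, hl2, h2⟩ := ex w2 hw2
    refine ⟨![l1, l2], ?_, ?_⟩
    · intro i; fin_cases i
      · exact hl1
      · exact hl2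
    · intro S hS
      have hm := Set.mem_iInter.1 hw ⟨S, hS⟩
      simp only [t, Set.mem_compl_iff, Set.mem_ofPred_eq] at hm
      push Not at hm
      obtain ⟨p, hp, hz⟩ := hm
      refine ⟨p, hp, ?_⟩
      rw [Set.mem_iUnion]
      rcases mul_eq_zero.1 hz with hz | hz
      · exact ⟨0, h1 p hz⟩
      · exact ⟨1, h2 p hz⟩
  · intro S
    rw [isClosed_compl_iff]
    apply isOpen_forall_cpt (hc _ S.2)
    apply isOpen_ne_fun
    · simp only [Q]; fun_prop
    · fun_prop
  · intro u
    obtain ⟨L, hL, hp⟩ := hcon ((fun S : F => (S : Set Plane)) '' (u : Set F))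
      (by rintro _ ⟨S, -, rfl⟩; exact S.2) (u.finite_toSet.image _)
    obtain ⟨w1, hw1, h1⟩ := eq_of_line _ (hL 0)
    obtain ⟨w2, hw2, h2⟩ := eq_of_line _ (hL 1)
    refine ⟨(w1, w2), ⟨by simpa using hw1, by simpa using hw2⟩, ?_⟩
    simp only [Set.mem_iInter]
    intro S hS
    obtain ⟨p, hpS, hpl⟩ := hp S ⟨S, hS, rfl⟩
    simp only [t, Set.mem_compl_iff, Set.mem_ofPred_eq]
    push Not
    refine ⟨p, hpS, ?_⟩
    rw [Set.mem_iUnion] at hpl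
    obtain ⟨i, hi⟩ := hpl
    fin_cases i
    · exact mul_eq_zero_of_left (h1 p hi) _
    · exact mul_eq_zero_of_right _ (h2 p hi)

noncomputable def chordG (R a b : ℝ) (p : Plane) : ℝ :=
  p 0 * Real.cos ((a + b) / 2) + p 1 * Real.sin ((a + b) / 2) - R * Real.cos ((b - a) / 2)

theorem chordG_flip (R a b : ℝ) (p : Plane) :
    chordG R b (a + 2 * Real.pi) p = - chordG R a b p := by
  unfold chordG
  rw [show (b + (a + 2 * Real.pi)) / 2 = (a + b) / 2 + Real.pi by ring,
    show (a + 2 * Real.pi - b) / 2 = Real.pi - (b - a) / 2 by ring,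
    Real.cos_add_pi, Real.sin_add_pi, Real.cos_pi_sub]
  ring

theorem chordG_mono (R a b c : ℝ) (p : Plane) (hR : 0 < R) (hp : p 0 ^ 2 + p 1 ^ 2 < R ^ 2)
    (hab : a ≤ b) (hbc : b ≤ c) (hca : c ≤ a + 2 * Real.pi) (h : 0 < chordG R a b p) :
    0 ≤ chordG R a c p := by
  have hs : 0 < R - (p 0 * Real.cos a + p 1 * Real.sin a) := by
    have h1 := Real.sin_sq_add_cos_sq a
    have : (p 0 * Real.cos a + p 1 * Real.sin a) ^ 2 < R ^ 2 := by
      have : (p 0 * Real.cos a + p 1 * Real.sin a) ^ 2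
        = (p 0 ^ 2 + p 1 ^ 2) * (Real.sin a ^ 2 + Real.cos a ^ 2)
          - (p 0 * Real.sin a - p 1 * Real.cos a) ^ 2 := by ring
      rw [this, h1]
      nlinarith [sq_nonneg (p 0 * Real.sin a - p 1 * Real.cos a)]
    have := abs_lt_of_sq_lt_sq this hR.le
    linarith [le_abs_self (p 0 * Real.cos a + p 1 * Real.sin a)]
  have form : ∀ d, chordG R a d p = (p 1 * Real.cos a - p 0 * Real.sin a) * Real.sin ((d - a) / 2)
      - (R - (p 0 * Real.cos a + p 1 * Real.sin a)) * Real.cos ((d - a) / 2) := by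
    intro d
    unfold chordG
    rw [show (a + d) / 2 = a + (d - a) / 2 by ring, Real.cos_add, Real.sin_add]
    ring
  rw [form] at h ⊢
  generalize R - (p 0 * Real.cos a + p 1 * Real.sin a) = s at *
  generalize p 1 * Real.cos a - p 0 * Real.sin a = y at *
  have hβ0 : 0 ≤ (b - a) / 2 := by linarith
  have hγ1 : (c - a) / 2 ≤ Real.pi := by linarith
  have hβγ : (b - a) / 2 ≤ (c - a) / 2 := by linarith
  generalize (b - a) / 2 = β at *
  generalize (c - a) / 2 = γ at *
  rcases hβ0.eq_or_lt with h0 | h0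
  · rw [← h0] at h
    simp at h; linarith
  rcases hγ1.eq_or_lt with h1 | h1
  · rw [h1]; simp [hs.le]
  have sβ : 0 < Real.sin β := Real.sin_pos_of_pos_of_lt_pi h0 (by linarith)
  have sγ : 0 < Real.sin γ := Real.sin_pos_of_pos_of_lt_pi (by linarith) h1
  have sd : 0 ≤ Real.sin (γ - β) := Real.sin_nonneg_of_nonneg_of_le_pi (by linarith) (by linarith)
  rw [Real.sin_sub] at sd
  have : 0 ≤ Real.sin β * (y * Real.sin γ - s * Real.cos γ) := by
    have e : Real.sin β * (y * Real.sin γ - s * Real.cos γ) =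
      Real.sin γ * (y * Real.sin β - s * Real.cos β)
        + s * (Real.sin γ * Real.cos β - Real.cos γ * Real.sin β) := by ring
    rw [e]
    exact add_nonneg (mul_pos sγ h).le (mul_nonneg hs.le sd)
  exact nonneg_of_mul_nonneg_right this sβ

theorem chord_line (R a b : ℝ) : ∃ l : Set Plane, IsLine l ∧
    ∀ p : Plane, chordG R a b p = 0 → p ∈ l := by
  obtain ⟨l, hl, h⟩ := line_of_eq (Real.cos ((a + b) / 2)) (Real.sin ((a + b) / 2))
    (- R * Real.cos ((b - a) / 2)) (by
      by_contra! h
      have := Real.sin_sq_add_cos_sq ((a + b) / 2)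
      rw [h.1, h.2] at this
      norm_num at this)
  refine ⟨l, hl, fun p hp => h p ?_⟩
  rw [← hp]; unfold chordG; ring

theorem four_signs (α β γ δ a b c d : ℝ)
    (ha1 : α + β * a < 0) (ha2 : γ + δ * a < 0)
    (hb1 : 0 < α + β * b) (hb2 : γ + δ * b < 0)
    (hc1 : 0 < α + β * c) (hc2 : 0 < γ + δ * c)
    (hd1 : α + β * d < 0) (hd2 : 0 < γ + δ * d) : False := by
  have e1 : 0 < β * (b - d) := by linarith
  have e2 : 0 < β * (c - a) := by linarith
  have e3 : 0 < δ * (d - b) := by linarith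
  have e4 : 0 < δ * (c - a) := by linarith
  rcases lt_trichotomy β 0 with h | h | h
  · have := neg_of_mul_pos_right e1 h.le
    have := neg_of_mul_pos_right e2 h.le
    nlinarith
  · simp [h] at e1
  · have := (mul_pos_iff_of_pos_left h).1 e1
    have := (mul_pos_iff_of_pos_left h).1 e2
    nlinarith

theorem const_sign (S : Set Plane) (hS : IsConnected S) (g : Plane → ℝ) (hg : Continuous g)
    (h : ∀ p ∈ S, g p ≠ 0) : (∀ p ∈ S, 0 < g p) ∨ (∀ p ∈ S, g p < 0) := by
  by_contra! hcon
  obtain ⟨⟨p, hp, hp'⟩, q, hq, hq'⟩ := hcon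
  obtain ⟨r, hr, hr'⟩ := hS.isPreconnected.intermediate_value hp hq hg.continuousOn ⟨hp', hq'⟩
  exact h r hr hr'

noncomputable def gA (R : ℝ) (u : ℝ × ℝ × ℝ) (p : Plane) : ℝ :=
  chordG R (2 * Real.pi * (u.1 * u.2.1 * u.2.2)) (2 * Real.pi * u.2.2) p
noncomputable def gB (R : ℝ) (u : ℝ × ℝ × ℝ) (p : Plane) : ℝ :=
  chordG R (2 * Real.pi * (u.2.1 * u.2.2)) (2 * Real.pi) p
noncomputable def sgA : Fin 4 → ℝ := ![-1, 1, 1, -1]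
noncomputable def sgB : Fin 4 → ℝ := ![-1, -1, 1, 1]

def inReg (R : ℝ) (i : Fin 4) (u : ℝ × ℝ × ℝ) (p : Plane) : Prop :=
  0 < sgA i * gA R u p ∧ 0 < sgB i * gB R u p

theorem gA_cont (R : ℝ) : Continuous fun x : (ℝ × ℝ × ℝ) × Plane => gA R x.1 x.2 := by
  unfold gA chordG; fun_prop
theorem gB_cont (R : ℝ) : Continuous fun x : (ℝ × ℝ × ℝ) × Plane => gB R x.1 x.2 := by
  unfold gB chordG; fun_prop

theorem forb (R : ℝ) (hR : 0 < R) (u : ℝ × ℝ × ℝ) (p : Plane) (hp : p 0 ^ 2 + p 1 ^ 2 < R ^ 2)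
    (h1 : 0 ≤ u.1) (h1' : u.1 ≤ 1) (h2 : 0 ≤ u.2.1) (h2' : u.2.1 ≤ 1)
    (h3 : 0 ≤ u.2.2) (h3' : u.2.2 ≤ 1) :
    (u.1 * u.2.1 * u.2.2 = 0 → ¬ inReg R 0 u p) ∧
    (u.1 * u.2.1 * u.2.2 = u.2.1 * u.2.2 → ¬ inReg R 1 u p) ∧
    (u.2.1 * u.2.2 = u.2.2 → ¬ inReg R 2 u p) ∧
    (u.2.2 = 1 → ¬ inReg R 3 u p) := by
  have pi := Real.pi_pos
  have m1 : 0 ≤ u.1 * u.2.1 * u.2.2 := by positivity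
  have m2 : u.1 * u.2.1 * u.2.2 ≤ u.2.1 * u.2.2 := by
    rw [mul_assoc]; exact mul_le_of_le_one_left (by positivity) h1'
  have m3 : u.2.1 * u.2.2 ≤ u.2.2 := mul_le_of_le_one_left h3 h2'
  unfold inReg gA gB
  generalize u.1 * u.2.1 * u.2.2 = t1 at *
  generalize u.2.1 * u.2.2 = t2 at *
  generalize u.2.2 = t3 at *
  have M1 : 0 ≤ 2 * Real.pi * t1 := by positivity
  have M2 : 2 * Real.pi * t1 ≤ 2 * Real.pi * t2 := by gcongr
  have M3 : 2 * Real.pi * t2 ≤ 2 * Real.pi * t3 := by gcongr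
  have M4 : 2 * Real.pi * t3 ≤ 2 * Real.pi := by nlinarith
  refine ⟨?_, ?_, ?_, ?_⟩ <;> rintro h ⟨ha, hb⟩ <;> simp [sgA, sgB] at ha hb
  · rw [h, mul_zero] at ha M1 M2
    have e := chordG_flip R 0 (2 * Real.pi * t2) p
    rw [zero_add] at e
    have := chordG_mono R 0 (2 * Real.pi * t2) (2 * Real.pi * t3) p hR hp M2 M3 (by linarith)
      (by linarith)
    linarith
  · rw [h] at ha
    have := chordG_mono R (2 * Real.pi * t2) (2 * Real.pi * t3) (2 * Real.pi) p hR hp M3 M4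
      (by linarith) ha
    linarith
  · have e := chordG_flip R (2 * Real.pi * t1) (2 * Real.pi * t2) p
    rw [← h] at ha
    have := chordG_mono R (2 * Real.pi * t2) (2 * Real.pi) (2 * Real.pi * t1 + 2 * Real.pi) p hR hp
      (by linarith) (by linarith) (by linarith) hb
    linarith
  · rw [h, mul_one] at ha M3
    have e1 := chordG_flip R (2 * Real.pi * t1) (2 * Real.pi) p
    have e2 := chordG_flip R (2 * Real.pi * t2) (2 * Real.pi) p
    have := chordG_mono R (2 * Real.pi) (2 * Real.pi * t1 + 2 * Real.pi)
      (2 * Real.pi * t2 + 2 * Real.pi) p hR hp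
      (by linarith) (by linarith) (by linarith) (by linarith)
    linarith

theorem exists_reg (F : Set (Set Plane)) (hconn : ∀ S ∈ F, IsConnected S)
    (hnp : ¬ PiercedByLines F 2) (R : ℝ) (u : ℝ × ℝ × ℝ) :
    ∃ i, ∃ S ∈ F, ∀ p ∈ S, inReg R i u p := by
  obtain ⟨l1, hl1, h1⟩ := chord_line R (2 * Real.pi * (u.1 * u.2.1 * u.2.2)) (2 * Real.pi * u.2.2)
  obtain ⟨l2, hl2, h2⟩ := chord_line R (2 * Real.pi * (u.2.1 * u.2.2)) (2 * Real.pi)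
  have : ∃ S ∈ F, ∀ p ∈ S, p ∉ l1 ∧ p ∉ l2 := by
    by_contra! hcon
    apply hnp
    refine ⟨![l1, l2], ?_, ?_⟩
    · intro i; fin_cases i
      · exact hl1
      · exact hl2
    · intro S hS
      obtain ⟨p, hp, hpl⟩ := hcon S hS
      refine ⟨p, hp, ?_⟩
      rw [Set.mem_iUnion]
      by_cases h : p ∈ l1
      · exact ⟨0, h⟩
      · exact ⟨1, hpl h⟩
  obtain ⟨S, hS, hd⟩ := this
  have cA := const_sign S (hconn S hS) (gA R u) ((gA_cont R).comp (Continuous.prodMk_right u))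
    (fun p hp h => (hd p hp).1 (h1 p h))
  have cB := const_sign S (hconn S hS) (gB R u) ((gB_cont R).comp (Continuous.prodMk_right u))
    (fun p hp h => (hd p hp).2 (h2 p h))
  rcases cA with cA | cA <;> rcases cB with cB | cB
  · exact ⟨2, S, hS, fun p hp => ⟨by simpa [sgA] using cA p hp, by simpa [sgB] using cB p hp⟩⟩
  · exact ⟨1, S, hS, fun p hp => ⟨by simpa [sgA] using cA p hp, by simpa [sgB] using cB p hp⟩⟩
  · exact ⟨3, S, hS, fun p hp => ⟨by simpa [sgA] using cA p hp, by simpa [sgB] using cB p hp⟩⟩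
  · exact ⟨0, S, hS, fun p hp => ⟨by simpa [sgA] using cA p hp, by simpa [sgB] using cB p hp⟩⟩

theorem chordG_affine (R a b : ℝ) (q v : Plane) : ∃ α β : ℝ, ∀ t : ℝ,
    chordG R a b (q + t • v) = α + β * t := by
  refine ⟨chordG R a b q, v 0 * Real.cos ((a + b) / 2) + v 1 * Real.sin ((a + b) / 2), fun t => ?_⟩
  simp [chordG]; ring

theorem no_transversal (R : ℝ) (u : ℝ × ℝ × ℝ) (l : Set Plane) (hl : IsLine l)
    (x : Fin 4 → Plane) (hx : ∀ i, x i ∈ l) (hr : ∀ i, inReg R i u (x i)) : False := by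
  obtain ⟨q, v, -, rfl⟩ := hl
  choose t ht using hx
  obtain ⟨α, β, hA⟩ := chordG_affine R (2 * Real.pi * (u.1 * u.2.1 * u.2.2)) (2 * Real.pi * u.2.2) q v
  obtain ⟨γ, δ, hB⟩ := chordG_affine R (2 * Real.pi * (u.2.1 * u.2.2)) (2 * Real.pi) q v
  have h : ∀ i, 0 < sgA i * (α + β * t i) ∧ 0 < sgB i * (γ + δ * t i) := by
    intro i
    have := hr i
    unfold inReg gA gB at this
    rwa [ht i, hA, hB] at this
  have h0 := h 0
  have h1 := h 1
  have h2 := h 2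
  have h3 := h 3
  simp [sgA, sgB] at h0 h1 h2 h3
  exact four_signs α β γ δ (t 0) (t 1) (t 2) (t 3) (by linarith) (by linarith) (by linarith)
    (by linarith) (by linarith) (by linarith) (by linarith) (by linarith)

theorem main_bdd (F : Fin 4 → Set (Set Plane))
    (hcpt : ∀ j, ∀ S ∈ F j, IsCompact S)
    (hconn : ∀ j, ∀ S ∈ F j, IsConnected S)
    (hT : ∀ A : Fin 4 → Set Plane, (∀ j, A j ∈ F j) →
      ∃ l : Set Plane, IsLine l ∧ ∀ j, (A j ∩ l).Nonempty)
    (hnp : ∀ j, ¬ PiercedByLines (F j) 2)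
    (R : ℝ) (hR : 0 < R) (hb : ∀ j, ∀ S ∈ F j, ∀ p ∈ S, p 0 ^ 2 + p 1 ^ 2 < R ^ 2) : False := by
  let A : Fin 4 → Fin 4 → Set (ℝ × ℝ × ℝ) := fun c i =>
    {u | ∃ S ∈ F c, ∀ p ∈ S, inReg R i u p}
  have hopen : ∀ c i, IsOpen (A c i) := by
    intro c i
    have : A c i = ⋃ S ∈ F c, {u | ∀ p ∈ S, (u, p) ∈ {x : (ℝ × ℝ × ℝ) × Plane |
        inReg R i x.1 x.2}} := by
      ext u; simp [A]
    rw [this]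
    refine isOpen_biUnion fun S hS => isOpen_forall_cpt (hcpt c S hS) _ ?_
    exact (isOpen_lt continuous_const (continuous_const.mul (gA_cont R))).inter
      (isOpen_lt continuous_const (continuous_const.mul (gB_cont R)))
  have hcube : IsCompact (Icc (0 : ℝ × ℝ × ℝ) 1) := isCompact_Icc
  have hleb : ∀ c, ∃ δ > 0, ∀ x ∈ Icc (0 : ℝ × ℝ × ℝ) 1, ∃ i, Metric.ball x δ ⊆ A c i := by
    intro c
    refine lebesgue_number_lemma_of_metric hcube (hopen c) ?_
    intro u _
    rw [Set.mem_iUnion]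
    exact exists_reg (F c) (hconn c) (hnp c) R u
  choose δ hδ hL using hleb
  obtain ⟨ε, hε, hεδ⟩ : ∃ ε > 0, ∀ c, ε ≤ δ c := by
    refine ⟨min (min (δ 0) (δ 1)) (min (δ 2) (δ 3)), by simp [hδ], ?_⟩
    intro c; fin_cases c <;> simp
  obtain ⟨n, hn⟩ := exists_nat_one_div_lt hε
  set N : ℕ := n + 1 with hN
  have hNpos : (0 : ℝ) < N := by positivity
  have hn : 1 / (N : ℝ) < ε := by simpa [hN] using hn
  let pt : ℕ → ℕ → ℕ → ℝ × ℝ × ℝ := fun i j k => ((i : ℝ) / N, (j : ℝ) / N, (k : ℝ) / N)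
  have hpt0 : ∀ i j k, 0 ≤ pt i j k := by
    intro i j k
    refine ⟨?_, ?_, ?_⟩ <;> simp [pt] <;> positivity
  have hdiv : ∀ i : ℕ, i ≤ N → (i : ℝ) / N ≤ 1 := fun i hi =>
    div_le_one_of_le₀ (by exact_mod_cast hi) hNpos.le
  have hptI : ∀ i j k, i ≤ N → j ≤ N → k ≤ N → pt i j k ∈ Icc (0 : ℝ × ℝ × ℝ) 1 := by
    intro i j k hi hj hk
    exact ⟨hpt0 i j k, hdiv i hi, hdiv j hj, hdiv k hk⟩
  let col : ℕ → Fin 4 := fun s => ⟨s % 4, Nat.mod_lt _ (by norm_num)⟩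
  have hlab : ∀ i j k, ∃ m : Fin 4, i ≤ N → j ≤ N → k ≤ N →
      Metric.ball (pt i j k) ε ⊆ A (col (i + j + k)) m := by
    intro i j k
    by_cases h : i ≤ N ∧ j ≤ N ∧ k ≤ N
    · obtain ⟨m, hm⟩ := hL (col (i + j + k)) _ (hptI i j k h.1 h.2.1 h.2.2)
      exact ⟨m, fun _ _ _ => (Metric.ball_subset_ball (hεδ _)).trans hm⟩
    · exact ⟨0, fun a b c => absurd ⟨a, b, c⟩ h⟩
  choose L hLab using hlab
  have hfb : ∀ i j k, i ≤ N → j ≤ N → k ≤ N → ∃ p : Plane, p 0 ^ 2 + p 1 ^ 2 < R ^ 2 ∧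
      inReg R (L i j k) (pt i j k) p := by
    intro i j k hi hj hk
    obtain ⟨S, hS, hSr⟩ := hLab i j k hi hj hk (Metric.mem_ball_self hε)
    obtain ⟨p, hp⟩ := (hconn _ S hS).nonempty
    exact ⟨p, hb _ S hS p hp, hSr p hp⟩
  have hforb : ∀ i j k, i ≤ N → j ≤ N → k ≤ N → 
      ((i : ℝ) / N * (j / N) * (k / N) = 0 → L i j k ≠ 0) ∧
      ((i : ℝ) / N * (j / N) * (k / N) = (j / N) * (k / N) → L i j k ≠ 1) ∧
      ((j : ℝ) / N * (k / N) = k / N → L i j k ≠ 2) ∧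
      ((k : ℝ) / N = 1 → L i j k ≠ 3) := by
    intro i j k hi hj hk
    obtain ⟨p, hp, hr⟩ := hfb i j k hi hj hk
    have h0 := hpt0 i j k
    obtain ⟨f0, f1, f2, f3⟩ := forb R hR (pt i j k) p hp h0.1 (hdiv i hi) h0.2.1 (hdiv j hj)
      h0.2.2 (hdiv k hk)
    refine ⟨fun h e => f0 h ?_, fun h e => f1 h ?_, fun h e => f2 h ?_, fun h e => f3 h ?_⟩ <;>
    · rw [e] at hr; exact hr
  have hNN : (N : ℝ) / N = 1 := div_self hNpos.ne'
  obtain ⟨i, j, k, hi, hj, hk, a, b, c, habc, hinj⟩ := sperner' N L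
    (by
      intro i j k hi hj hk h
      apply (hforb i j k hi hj hk).1
      rcases h with rfl | rfl | rfl <;> simp)
    (by
      intro i j k hi hj hk h
      apply (hforb i j k hi hj hk).2.1
      rcases h with rfl | rfl | rfl
      · rw [hNN]; ring
      · simp
      · simp)
    (by
      intro i j k hi hj hk h
      apply (hforb i j k hi hj hk).2.2.1
      rcases h with rfl | rfl
      · rw [hNN]; ring
      · simp)
    (by
      intro i j k hi hj hk h
      apply (hforb i j k hi hj hk).2.2.2
      rw [h, hNN])
  -- the common point
  have hmem : ∀ m : Fin 4, pt i j k ∈ A (col (i + j + k + m)) (L (a m) (b m) (c m)) := by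
    intro m
    obtain ⟨ha, hb', hc, hs⟩ := habc m
    have := hLab (a m) (b m) (c m) (by omega) (by omega) (by omega)
    rw [hs] at this
    apply this
    have hd : ∀ x y : ℕ, (y = x ∨ y = x + 1) → dist ((x : ℝ) / N) ((y : ℝ) / N) < ε := by
      rintro x y (rfl | rfl)
      · simpa using hε
      · rw [Real.dist_eq, ← sub_div, abs_div, abs_of_pos hNpos]
        simpa using hn
    rw [Metric.mem_ball, Prod.dist_eq, Prod.dist_eq]
    exact max_lt (hd _ _ ha) (max_lt (hd _ _ hb') (hd _ _ hc))
  have hcol : Function.Surjective fun m : Fin 4 => col (i + j + k + m) := by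
    rw [← Finite.injective_iff_surjective]
    intro x y hxy
    have : (i + j + k + x) % 4 = (i + j + k + y) % 4 := congrArg Fin.val hxy
    ext
    omega
  have hsurj := Finite.injective_iff_surjective.1 hinj
  choose σ hσ using hcol
  have hmem2 : ∀ d : Fin 4, ∃ S ∈ F d, ∀ p ∈ S,
      inReg R (L (a (σ d)) (b (σ d)) (c (σ d))) (pt i j k) p := by
    intro d
    have := hmem (σ d)
    rwa [show col (i + j + k + (σ d)) = d from hσ d] at this
  choose S hSF hSr using hmem2
  obtain ⟨l, hl, hlS⟩ := hT S hSF
  choose x hxS using hlS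
  have hcolinj : Function.Surjective σ := by
    rw [← Finite.injective_iff_surjective]
    intro d d' h
    rw [← hσ d, ← hσ d', h]
  choose τ hτ using hcolinj
  choose ρ hρ using hsurj
  refine no_transversal R (pt i j k) l hl (fun e => x (τ (ρ e))) (fun e => (hxS _).2) ?_
  intro e
  have := hSr (τ (ρ e)) _ (hxS _).1
  rw [hτ] at this
  rwa [show L (a (ρ e)) (b (ρ e)) (c (ρ e)) = e from hρ e] at this

theorem stmt_5 (F : Fin 4 → Set (Set Plane))
    (hne : ∀ j, ∀ S ∈ F j, S.Nonempty)
    (hcpt : ∀ j, ∀ S ∈ F j, IsCompact S)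
    (hconn : ∀ j, ∀ S ∈ F j, IsConnected S)
    (hT : ∀ A : Fin 4 → Set Plane, (∀ j, A j ∈ F j) →
      ∃ l : Set Plane, IsLine l ∧ ∀ j, (A j ∩ l).Nonempty) :
    ∃ i : Fin 4, PiercedByLines (F i) 2 := by
  by_contra! hnp
  choose F' hsub hfin hnp' using fun j => exists_finite (F j) (hcpt j) (hnp j)
  have hbd : Bornology.IsBounded (⋃ j, ⋃ S ∈ F' j, S) := by
    rw [Bornology.isBounded_iUnion]
    intro j
    rw [Bornology.isBounded_biUnion (hfin j)]
    exact fun S hS => (hcpt j S (hsub j hS)).isBounded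
  obtain ⟨R, hR, hRb⟩ := hbd.exists_pos_norm_lt
  refine main_bdd F' (fun j S hS => hcpt j S (hsub j hS)) (fun j S hS => hconn j S (hsub j hS))
    (fun A hA => hT A fun j => hsub j (hA j)) hnp' R hR ?_
  intro j S hS p hp
  have h := hRb p (Set.mem_iUnion.2 ⟨j, Set.mem_biUnion hS hp⟩)
  have h2 : ‖p‖ ^ 2 < R ^ 2 := by gcongr
  rw [EuclideanSpace.norm_sq_eq] at h2
  simpa [Fin.sum_univ_two] using h2
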